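/- Let Φ : [0,∞) → ℝ be convex and three times continuously differentiable on (0,∞) with Φ''(1) > 0. Then for every admissible pair (μ,K) on finite alphabets X and Y, η_Φ(μ,K) ≥ S(μ,K)², where S(μ,K) is the maximal correlation of (μ,K). -/

import Mathlib

open Finset

noncomputable section

namespace SDPI

variable {X Y : Type} [Fintype X] [Fintype Y]

def IsDist (μ : X → ℝ) : Prop := (∀ x, 0 ≤ μ x) ∧ ∑ x, μ x = 1

def IsPosDist (μ : X → ℝ) : Prop := (∀ x, 0 < μ x) ∧ ∑ x, μ x = 1

def IsChannel (K : X → Y → ℝ) : Prop :=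
  (∀ x y, 0 ≤ K x y) ∧ ∀ x, ∑ y, K x y = 1

def push (μ : X → ℝ) (K : X → Y → ℝ) : Y → ℝ := fun y => ∑ x, μ x * K x y

def fDiv (Φ : ℝ → ℝ) (ν μ : X → ℝ) : ℝ := (∑ x, μ x * Φ (ν x / μ x)) - Φ 1

def eta (Φ : ℝ → ℝ) (μ : X → ℝ) (K : X → Y → ℝ) : ℝ :=
  sSup { r | ∃ ν : X → ℝ, IsDist ν ∧ ν ≠ μ ∧
    r = fDiv Φ (push ν K) (push μ K) / fDiv Φ ν μ }

def etaSup (Φ : ℝ → ℝ) (K : X → Y → ℝ) : ℝ :=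
  sSup { r | ∃ μ : X → ℝ, IsPosDist μ ∧ r = eta Φ μ K }

def maxCorr (μ : X → ℝ) (K : X → Y → ℝ) : ℝ :=
  sSup { r | ∃ (f : X → ℝ) (g : Y → ℝ),
    (∑ x, μ x * f x) = 0 ∧ (∑ y, push μ K y * g y) = 0 ∧
    (∑ x, μ x * (f x) ^ 2) = 1 ∧ (∑ y, push μ K y * (g y) ^ 2) = 1 ∧
    r = ∑ x, ∑ y, μ x * K x y * (f x * g y) }

def adjoint (μ : X → ℝ) (K : X → Y → ℝ) : Y → X → ℝ :=
  fun y x => K x y * μ x / push μ K y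

def Ent (Φ : ℝ → ℝ) (μ : X → ℝ) (f : X → ℝ) : ℝ :=
  (∑ x, μ x * Φ (f x)) - Φ (∑ x, μ x * f x)

def Var (μ : X → ℝ) (f : X → ℝ) : ℝ :=
  ∑ x, μ x * (f x - ∑ x', μ x' * f x') ^ 2

def condExp (μ : X → ℝ) (K : X → Y → ℝ) (f : X → ℝ) : Y → ℝ :=
  fun y => (∑ x, μ x * K x y * f x) / push μ K y

def calE (μ : X → ℝ) (K : X → Y → ℝ) (f g : X → ℝ) : ℝ :=
  ∑ x, ∑ y, μ x * K x y *
    ((f x - condExp μ K f y) * (g x - condExp μ K g y))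

def dirichlet (μ : X → ℝ) (M : X → X → ℝ) (f g : X → ℝ) : ℝ :=
  (1 / 2) * ∑ x, ∑ x', μ x * M x x' * ((f x - f x') * (g x - g x'))

def Homogeneous (Φ : ℝ → ℝ) : Prop :=
  ∃ κ : ℝ → ℝ, (∀ c : ℝ, 0 < c → 0 < κ c) ∧
    ∀ (c : ℝ), 0 < c → ∀ (Z : Type) [Fintype Z], ∀ (μ : Z → ℝ),
      IsDist μ → ∀ f : Z → ℝ, (∀ z, 0 ≤ f z) →
        Ent Φ μ (fun z => c * f z) = κ c * Ent Φ μ f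

def Subadditive (Φ : ℝ → ℝ) : Prop :=
  ∀ (n : ℕ) (Z : Fin n → Type) [∀ i, Fintype (Z i)],
    ∀ (μ : ∀ i, Z i → ℝ), (∀ i, IsDist (μ i)) →
    ∀ f : (∀ i, Z i) → ℝ, (∀ z, 0 ≤ f z) →
      Ent Φ (fun z : ∀ i, Z i => ∏ i, μ i (z i)) f ≤
        ∑ i : Fin n,
          ((∑ z : ∀ j, Z j, (∏ j, μ j (z j)) * Φ (f z)) -
            ∑ z : ∀ j, Z j, (∏ j, μ j (z j)) *
              Φ (∑ w : Z i, μ i w * f (Function.update z i w)))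


/-- Second-order Peano expansion at `1`, along the ray of slope `a`. -/
lemma tendsto_second_order {Φ Φ' Φ'' : ℝ → ℝ}
    (hd1 : ∀ u ∈ Set.Ioi (0:ℝ), HasDerivAt Φ (Φ' u) u)
    (hd2 : ∀ u ∈ Set.Ioi (0:ℝ), HasDerivAt Φ' (Φ'' u) u) (a : ℝ) :
    Filter.Tendsto (fun t : ℝ => (Φ (1 + t * a) - Φ 1 - t * a * Φ' 1) / t ^ 2)
      (nhdsWithin 0 {0}ᶜ) (nhds (Φ'' 1 / 2 * a ^ 2)) := by
  have hline (t : ℝ) : HasDerivAt (fun t : ℝ => 1 + t * a) a t := by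
    simpa using ((hasDerivAt_id t).mul_const a).const_add 1
  have hpos : ∀ᶠ t : ℝ in nhds 0, 0 < 1 + t * a := by
    have h : ContinuousAt (fun t : ℝ => 1 + t * a) 0 := (hline 0).continuousAt
    exact h.eventually (lt_mem_nhds (by simp))
  have hnum : ∀ᶠ t : ℝ in nhds 0, HasDerivAt
      (fun t : ℝ => Φ (1 + t * a) - Φ 1 - t * a * Φ' 1)
      (Φ' (1 + t * a) * a - a * Φ' 1) t := by
    filter_upwards [hpos] with t ht
    have h := (hd1 _ ht).comp t (hline t)
    have h' : HasDerivAt (fun t : ℝ => t * a * Φ' 1) (a * Φ' 1) t := by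
      simpa using ((hasDerivAt_id t).mul_const a).mul_const (Φ' 1)
    exact (h.sub_const (Φ 1)).sub h'
  refine HasDerivAt.lhopital_zero_nhdsNE (f' := fun t => Φ' (1 + t * a) * a - a * Φ' 1)
    (g' := fun t => 2 * t) (hnum.filter_mono nhdsWithin_le_nhds)
    (Filter.Eventually.of_forall fun t => by simpa using hasDerivAt_pow 2 t) ?_ ?_ ?_ ?_
  · filter_upwards [self_mem_nhdsWithin] with t ht
    exact mul_ne_zero two_ne_zero ht
  · have h := hnum.self_of_nhds.continuousAt.tendsto
    simp only [zero_mul, add_zero, sub_self] at h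
    exact h.mono_left nhdsWithin_le_nhds
  · have h := (hasDerivAt_pow 2 (0:ℝ)).continuousAt.tendsto
    simp only [ne_eq, OfNat.ofNat_ne_zero, not_false_eq_true, zero_pow] at h
    exact h.mono_left nhdsWithin_le_nhds
  · have h1 : HasDerivAt Φ' (Φ'' 1) (1 + 0 * a) := by simpa using hd2 1 (by simp)
    have h := (h1.comp (0:ℝ) (hline 0)).tendsto_slope
    have h2 := h.mul_const (a / 2)
    have e : Φ'' 1 * a * (a / 2) = Φ'' 1 / 2 * a ^ 2 := by ring
    rw [e] at h2
    refine h2.congr' ?_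
    filter_upwards [self_mem_nhdsWithin] with t ht
    have ht' : t ≠ 0 := ht
    simp only [slope_def_field, Function.comp_apply, zero_mul, add_zero, sub_zero]
    field_simp

/-- Infinitesimally the `Φ`-divergence is a multiple of the variance. -/
lemma tendsto_fDiv_div_sq {Z : Type} [Fintype Z] {Φ Φ' Φ'' : ℝ → ℝ}
    (hd1 : ∀ u ∈ Set.Ioi (0:ℝ), HasDerivAt Φ (Φ' u) u)
    (hd2 : ∀ u ∈ Set.Ioi (0:ℝ), HasDerivAt Φ' (Φ'' u) u)
    {μ f : Z → ℝ} (hμ : IsPosDist μ) (hf : ∑ z, μ z * f z = 0) :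
    Filter.Tendsto (fun t : ℝ => fDiv Φ (fun z => μ z * (1 + t * f z)) μ / t ^ 2)
      (nhdsWithin 0 {0}ᶜ) (nhds (Φ'' 1 / 2 * ∑ z, μ z * f z ^ 2)) := by
  have h := tendsto_finsetSum univ fun z _ =>
    (tendsto_second_order hd1 hd2 (f z)).const_mul (μ z)
  have e : ∑ z, μ z * (Φ'' 1 / 2 * f z ^ 2) = Φ'' 1 / 2 * ∑ z, μ z * f z ^ 2 := by
    rw [mul_sum]; exact sum_congr rfl fun z _ => by ring
  rw [e] at h
  refine h.congr fun t => ?_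
  have hq (z : Z) : μ z * (1 + t * f z) / μ z = 1 + t * f z :=
    mul_div_cancel_left₀ _ (hμ.1 z).ne'
  have hs : ∑ z, μ z * (Φ (1 + t * f z) - Φ 1 - t * f z * Φ' 1) =
      ∑ z, μ z * Φ (1 + t * f z) - (∑ z, μ z) * Φ 1 - t * Φ' 1 * ∑ z, μ z * f z := by
    rw [sum_mul, mul_sum, ← sum_sub_distrib, ← sum_sub_distrib]
    exact sum_congr rfl fun z _ => by ring
  simp only [fDiv, hq]
  rw [hμ.2, hf, one_mul, mul_zero, sub_zero] at hs
  rw [← hs, sum_div]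
  exact sum_congr rfl fun z _ => by ring

lemma sum_push {K : X → Y → ℝ} (hK : IsChannel K) (ν : X → ℝ) :
    ∑ y, push ν K y = ∑ x, ν x := by
  simp only [push]
  rw [sum_comm]
  exact sum_congr rfl fun x _ => by rw [← mul_sum, hK.2, mul_one]

lemma fDiv_nonneg {Z : Type} [Fintype Z] {Φ : ℝ → ℝ} (hconv : ConvexOn ℝ (Set.Ici 0) Φ)
    {μ ν : Z → ℝ} (hμ : IsPosDist μ) (hν : IsDist ν) : 0 ≤ fDiv Φ ν μ := by
  have h := hconv.map_sum_le (t := univ) (w := μ) (p := fun z => ν z / μ z)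
    (fun z _ => (hμ.1 z).le) hμ.2 (fun z _ => div_nonneg (hν.1 z) (hμ.1 z).le)
  have e : ∑ z, μ z • (ν z / μ z) = 1 := by
    rw [← hν.2]
    exact sum_congr rfl fun z _ => mul_div_cancel₀ _ (hμ.1 z).ne'
  rw [e] at h
  exact sub_nonneg.2 h

/-- Data processing inequality. -/
lemma fDiv_push_le {Φ : ℝ → ℝ} (hconv : ConvexOn ℝ (Set.Ici 0) Φ)
    {μ ν : X → ℝ} {K : X → Y → ℝ} (hμ : IsPosDist μ) (hν : IsDist ν) (hK : IsChannel K)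
    (hadm : ∀ y, 0 < push μ K y) :
    fDiv Φ (push ν K) (push μ K) ≤ fDiv Φ ν μ := by
  have key (y : Y) : push μ K y * Φ (push ν K y / push μ K y) ≤
      ∑ x, μ x * K x y * Φ (ν x / μ x) := by
    have h := hconv.map_sum_le (t := univ) (w := fun x => μ x * K x y / push μ K y)
      (p := fun x => ν x / μ x)
      (fun x _ => div_nonneg (mul_nonneg (hμ.1 x).le (hK.1 x y)) (hadm y).le)
      (by rw [← sum_div]; exact div_self (hadm y).ne')
      (fun x _ => div_nonneg (hν.1 x) (hμ.1 x).le)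
    have e : ∑ x, (μ x * K x y / push μ K y) • (ν x / μ x) = push ν K y / push μ K y := by
      conv_rhs => rw [push, sum_div]
      refine sum_congr rfl fun x _ => ?_
      have := (hμ.1 x).ne'
      have := (hadm y).ne'
      simp only [smul_eq_mul]
      field_simp
    rw [e] at h
    refine (mul_le_mul_of_nonneg_left h (hadm y).le).trans_eq ?_
    rw [mul_sum]
    refine sum_congr rfl fun x _ => ?_
    have := (hadm y).ne'
    simp only [smul_eq_mul]
    field_simp
  refine sub_le_sub_right ((sum_le_sum fun y _ => key y).trans_eq ?_) _
  rw [sum_comm]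
  exact sum_congr rfl fun x _ => by rw [← sum_mul, ← mul_sum, hK.2, mul_one]

lemma IsDist.push {ν : X → ℝ} {K : X → Y → ℝ} (hν : IsDist ν) (hK : IsChannel K) :
    IsDist (push ν K) :=
  ⟨fun y => sum_nonneg fun x _ => mul_nonneg (hν.1 x) (hK.1 x y), (sum_push hK ν).trans hν.2⟩

lemma fDiv_ratio_mem_Icc {Φ : ℝ → ℝ} (hconv : ConvexOn ℝ (Set.Ici 0) Φ)
    {μ ν : X → ℝ} {K : X → Y → ℝ} (hμ : IsPosDist μ) (hν : IsDist ν) (hK : IsChannel K)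
    (hadm : ∀ y, 0 < push μ K y) :
    fDiv Φ (push ν K) (push μ K) / fDiv Φ ν μ ∈ Set.Icc 0 1 :=
  have hμK : IsPosDist (push μ K) := ⟨hadm, (sum_push hK μ).trans hμ.2⟩
  ⟨div_nonneg (fDiv_nonneg hconv hμK (hν.push hK)) (fDiv_nonneg hconv hμ hν),
    div_le_one_of_le₀ (fDiv_push_le hconv hμ hν hK hadm) (fDiv_nonneg hconv hμ hν)⟩

lemma eta_nonneg {Φ : ℝ → ℝ} (hconv : ConvexOn ℝ (Set.Ici 0) Φ)
    {μ : X → ℝ} {K : X → Y → ℝ} (hμ : IsPosDist μ) (hK : IsChannel K)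
    (hadm : ∀ y, 0 < push μ K y) : 0 ≤ eta Φ μ K := by
  refine Real.sSup_nonneg ?_
  rintro r ⟨ν, hν, -, rfl⟩
  exact (fDiv_ratio_mem_Icc hconv hμ hν hK hadm).1

lemma fDiv_ratio_le_eta {Φ : ℝ → ℝ} (hconv : ConvexOn ℝ (Set.Ici 0) Φ)
    {μ ν : X → ℝ} {K : X → Y → ℝ} (hμ : IsPosDist μ) (hν : IsDist ν) (hne : ν ≠ μ)
    (hK : IsChannel K) (hadm : ∀ y, 0 < push μ K y) :
    fDiv Φ (push ν K) (push μ K) / fDiv Φ ν μ ≤ eta Φ μ K := by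
  refine le_csSup ⟨1, ?_⟩ ⟨ν, hν, hne, rfl⟩
  rintro r ⟨ν', hν', -, rfl⟩
  exact (fDiv_ratio_mem_Icc hconv hμ hν' hK hadm).2

lemma push_mul_condExp {X Y : Type} [Fintype X] {μ f : X → ℝ} {K : X → Y → ℝ} {y : Y}
    (hy : 0 < push μ K y) :
    push μ K y * condExp μ K f y = ∑ x, μ x * K x y * f x :=
  mul_div_cancel₀ _ hy.ne'

lemma push_perturb {X Y : Type} [Fintype X] {μ f : X → ℝ} {K : X → Y → ℝ}
    (hadm : ∀ y, 0 < push μ K y) (t : ℝ) :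
    push (fun x => μ x * (1 + t * f x)) K =
      fun y => push μ K y * (1 + t * condExp μ K f y) := by
  funext y
  have h := push_mul_condExp (f := f) (hadm y)
  calc push (fun x => μ x * (1 + t * f x)) K y
      = push μ K y + t * ∑ x, μ x * K x y * f x := by
        simp only [push]
        rw [mul_sum, ← sum_add_distrib]
        exact sum_congr rfl fun x _ => by ring
    _ = _ := by rw [← h]; ring

/-- The second moment of the conditional expectation of a normalized function bounds `eta` below,
by perturbing `μ` in the direction of that function. -/
lemma sum_condExp_sq_le_eta {Φ Φ' Φ'' : ℝ → ℝ} (hconv : ConvexOn ℝ (Set.Ici 0) Φ)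
    (hd1 : ∀ u ∈ Set.Ioi (0:ℝ), HasDerivAt Φ (Φ' u) u)
    (hd2 : ∀ u ∈ Set.Ioi (0:ℝ), HasDerivAt Φ' (Φ'' u) u) (hΦ''1 : 0 < Φ'' 1)
    {μ f : X → ℝ} {K : X → Y → ℝ} (hμ : IsPosDist μ) (hK : IsChannel K)
    (hadm : ∀ y, 0 < push μ K y)
    (hf : ∑ x, μ x * f x = 0) (hf2 : ∑ x, μ x * f x ^ 2 = 1) :
    ∑ y, push μ K y * condExp μ K f y ^ 2 ≤ eta Φ μ K := by
  have hμK : IsPosDist (push μ K) := ⟨hadm, (sum_push hK μ).trans hμ.2⟩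
  have hh : ∑ y, push μ K y * condExp μ K f y = 0 := by
    simp only [push_mul_condExp (hadm _)]
    rw [sum_comm, ← hf]
    exact sum_congr rfl fun x _ => by rw [← sum_mul, ← mul_sum, hK.2, mul_one]
  have hden := tendsto_fDiv_div_sq hd1 hd2 hμ hf
  have hnum := tendsto_fDiv_div_sq hd1 hd2 hμK hh
  rw [hf2, mul_one] at hden
  have hlim := hnum.div hden (half_pos hΦ''1).ne'
  rw [mul_div_cancel_left₀ _ (half_pos hΦ''1).ne'] at hlim
  refine le_of_tendsto hlim ?_
  have hpos : ∀ᶠ t : ℝ in nhds 0, ∀ x, 0 < 1 + t * f x := by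
    refine Filter.eventually_all.2 fun x => ?_
    have h : ContinuousAt (fun t : ℝ => 1 + t * f x) 0 := by fun_prop
    exact h.eventually (lt_mem_nhds (by simp))
  filter_upwards [self_mem_nhdsWithin, hpos.filter_mono nhdsWithin_le_nhds] with t ht htpos
  have ht' : t ≠ 0 := ht
  have hν : IsDist fun x => μ x * (1 + t * f x) := by
    refine ⟨fun x => (mul_pos (hμ.1 x) (htpos x)).le, ?_⟩
    calc ∑ x, μ x * (1 + t * f x) = ∑ x, μ x + t * ∑ x, μ x * f x := by
          rw [mul_sum, ← sum_add_distrib]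
          exact sum_congr rfl fun x _ => by ring
      _ = 1 := by rw [hμ.2, hf]; ring
  have hne : (fun x => μ x * (1 + t * f x)) ≠ μ := by
    intro h
    have hf0 (x : X) : f x = 0 := by
      have hx : μ x * (1 + t * f x) = μ x := congrFun h x
      have hx' : μ x * (t * f x) = 0 := by linarith
      simpa [(hμ.1 x).ne', ht'] using hx'
    simp [hf0] at hf2
  have h := fDiv_ratio_le_eta hconv hμ hν hne hK hadm
  rw [push_perturb hadm t] at h
  rw [Pi.div_apply, div_div_div_cancel_right₀ (pow_ne_zero 2 ht')]
  exact h

/-- Correlations are bounded by the second moment of the conditional expectation. -/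
lemma sq_correlation_le {μ f : X → ℝ} {K : X → Y → ℝ} {g : Y → ℝ}
    (hadm : ∀ y, 0 < push μ K y) (hg2 : ∑ y, push μ K y * g y ^ 2 = 1) :
    (∑ x, ∑ y, μ x * K x y * (f x * g y)) ^ 2 ≤ ∑ y, push μ K y * condExp μ K f y ^ 2 := by
  have e : ∑ x, ∑ y, μ x * K x y * (f x * g y) =
      ∑ y, push μ K y * condExp μ K f y * g y := by
    rw [sum_comm]
    refine sum_congr rfl fun y _ => ?_
    rw [push_mul_condExp (hadm y), sum_mul]
    exact sum_congr rfl fun x _ => by ring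
  rw [e]
  have h := sum_sq_le_sum_mul_sum_of_sq_le_mul univ
    (r := fun y => push μ K y * condExp μ K f y * g y)
    (f := fun y => push μ K y * condExp μ K f y ^ 2) (g := fun y => push μ K y * g y ^ 2)
    (fun y _ => mul_nonneg (hadm y).le (sq_nonneg _))
    (fun y _ => mul_nonneg (hadm y).le (sq_nonneg _)) (fun y _ => by ring_nf; rfl)
  rwa [hg2, mul_one] at h

/-- Theorem: if `Φ : [0,∞) → ℝ` is convex and three times continuously differentiable
on `(0,∞)` with `Φ''(1) > 0`, then for every admissible pair `(μ,K)` on finite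
alphabets, `η_Φ(μ,K) ≥ S(μ,K)²`. -/
theorem statement2 {X Y : Type} [Fintype X] [Fintype Y] [Nonempty X] [Nonempty Y]
    (Φ Φ' Φ'' Φ''' : ℝ → ℝ)
    (hconv : ConvexOn ℝ (Set.Ici 0) Φ)
    (hd1 : ∀ u ∈ Set.Ioi (0:ℝ), HasDerivAt Φ (Φ' u) u)
    (hd2 : ∀ u ∈ Set.Ioi (0:ℝ), HasDerivAt Φ' (Φ'' u) u)
    (hd3 : ∀ u ∈ Set.Ioi (0:ℝ), HasDerivAt Φ'' (Φ''' u) u)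
    (hcont : ContinuousOn Φ''' (Set.Ioi 0))
    (hΦ''1 : 0 < Φ'' 1)
    (μ : X → ℝ) (K : X → Y → ℝ) (hμ : IsPosDist μ) (hK : IsChannel K)
    (hadm : ∀ y, 0 < push μ K y) :
    (maxCorr μ K) ^ 2 ≤ eta Φ μ K := by
  have hη := eta_nonneg hconv hμ hK hadm
  refine (Real.sq_le hη).2 ?_
  have hbound : ∀ r ∈ { r | ∃ (f : X → ℝ) (g : Y → ℝ),
      (∑ x, μ x * f x) = 0 ∧ (∑ y, push μ K y * g y) = 0 ∧
      (∑ x, μ x * (f x) ^ 2) = 1 ∧ (∑ y, push μ K y * (g y) ^ 2) = 1 ∧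
      r = ∑ x, ∑ y, μ x * K x y * (f x * g y) },
      -√(eta Φ μ K) ≤ r ∧ r ≤ √(eta Φ μ K) := by
    rintro r ⟨f, g, hf, -, hf2, hg2, rfl⟩
    exact (Real.sq_le hη).1 ((sq_correlation_le hadm hg2).trans
      (sum_condExp_sq_le_eta hconv hd1 hd2 hΦ''1 hμ hK hadm hf hf2))
  refine ⟨?_, Real.sSup_le (fun r hr => (hbound r hr).2) (Real.sqrt_nonneg _)⟩
  rw [maxCorr]
  rcases Set.eq_empty_or_nonempty { r | ∃ (f : X → ℝ) (g : Y → ℝ),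
      (∑ x, μ x * f x) = 0 ∧ (∑ y, push μ K y * g y) = 0 ∧
      (∑ x, μ x * (f x) ^ 2) = 1 ∧ (∑ y, push μ K y * (g y) ^ 2) = 1 ∧
      r = ∑ x, ∑ y, μ x * K x y * (f x * g y) } with h | ⟨r, hr⟩
  · rw [h, Real.sSup_empty]
    exact neg_nonpos.2 (Real.sqrt_nonneg _)
  · exact (hbound r hr).1.trans (le_csSup ⟨_, fun r hr => (hbound r hr).2⟩ hr)

end SDPI
end
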